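/- Let τ be an indeterminate, n ≥ 1, L = 2n+1, and 0 ≤ p ≤ n; set p̃ = n−p. Let F be the polynomial in ℤ[τ][u_1,…,u_n] given by F = ∏_{1≤ℓ≤m≤n}(1 − u_ℓ u_m)(1 + τ u_m + u_ℓ u_m) · ∏_{1≤ℓ<m≤n}(u_m − u_ℓ)(τ + u_ℓ + u_m). For an integer sequence b = (b_1,…,b_n), let ψ̄_b denote the coefficient in F of the monomial ∏_{ℓ=1}^{n} u_ℓ^{b_ℓ−1}. For ε = (ε_1,…,ε_p) ∈ {0,1}^p define b(ε) by b(ε)_ℓ = ℓ for 1 ≤ ℓ ≤ p̃ and b(ε)_ℓ = 2ℓ − p̃ − ε_{ℓ−p̃} for p̃+1 ≤ ℓ ≤ n, and for an indeterminate value t set S(L,p|t) := Σ_{ε ∈ {0,1}^p} t^{ε_1+⋯+ε_p} · ψ̄_{b(ε)}. Then, with ν = (n(n−1) − p(p+1))/2: S(L,p|τ) = τ^{ν} · T(L, p, n−p) and S(L,p|τ^{−1}) = τ^{ν} · T(L, p, n−p+1), these equalities holding in ℤ[τ, τ^{−1}] (note ν may be negative when p = n). -/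

import Mathlib

open Polynomial Finset MvPolynomial

/-- Binomial coefficient `C(a,b)` for integer arguments, equal to `0` if `b < 0` or `b > a`
    (for `a ≥ 0`). -/
def intChoose (a b : ℤ) : ℤ := if 0 ≤ b then (a.toNat.choose b.toNat : ℤ) else 0

/-- `T(L,p,k)`: the determinant of the `p × p` matrix whose `(ℓ,m)` entry (`1 ≤ ℓ, m ≤ p`) is
    `∑_{r=0}^{2p} C(ℓ+k-1, r-ℓ) C(m+L-2p-k, 2m-r) τ^{2(2m-r)}`, as a polynomial in `τ`. -/
noncomputable def Tpoly (L p k : ℤ) : Polynomial ℤ :=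
  Matrix.det (Matrix.of fun ℓ m : Fin p.toNat =>
    ∑ r ∈ Finset.range (2 * p.toNat + 1),
      Polynomial.C (intChoose ((ℓ : ℤ) + 1 + k - 1) ((r : ℤ) - ((ℓ : ℤ) + 1)) *
          intChoose (((m : ℤ) + 1) + L - 2 * p - k) (2 * ((m : ℤ) + 1) - (r : ℤ))) *
        Polynomial.X ^ (2 * (2 * ((m : ℤ) + 1) - (r : ℤ))).toNat)

/-- The polynomial `F ∈ ℤ[τ][u_1,…,u_n]` for odd size `L = 2n+1`:
    `F = ∏_{1≤ℓ≤m≤n}(1 - u_ℓ u_m)(1 + τ u_m + u_ℓ u_m) ∏_{1≤ℓ<m≤n}(u_m - u_ℓ)(τ + u_ℓ + u_m)`. -/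
noncomputable def Fodd (n : ℕ) : MvPolynomial (Fin n) (Polynomial ℤ) :=
  (∏ ℓ : Fin n, ∏ m : Fin n,
      if ℓ ≤ m then
        (1 - MvPolynomial.X ℓ * MvPolynomial.X m) *
          (1 + MvPolynomial.C Polynomial.X * MvPolynomial.X m +
            MvPolynomial.X ℓ * MvPolynomial.X m)
      else 1) *
    ∏ ℓ : Fin n, ∏ m : Fin n,
      if ℓ < m then
        (MvPolynomial.X m - MvPolynomial.X ℓ) *
          (MvPolynomial.C Polynomial.X + MvPolynomial.X ℓ + MvPolynomial.X m)
      else 1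

/-- `ψ̄_b`: the coefficient of the monomial `∏_ℓ u_ℓ^{e ℓ}` in `Fodd n`
    (here `e ℓ = b_ℓ - 1`). -/
noncomputable def psibarOdd (n : ℕ) (e : Fin n → ℕ) : Polynomial ℤ :=
  MvPolynomial.coeff (Finsupp.equivFunOnFinite.symm e) (Fodd n)

/-- The exponent vector `ℓ ↦ b(ε)_ℓ - 1` for odd size: `b(ε)_ℓ = ℓ` for `1 ≤ ℓ ≤ p̃` and
    `b(ε)_ℓ = 2ℓ - p̃ - ε_{ℓ-p̃}` for `p̃+1 ≤ ℓ ≤ n`; indices here are `0`-based, and `εf` is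
    the (`0`-based) sequence of `ε`-values. -/
def bEpsOdd (n ptil : ℕ) (εf : ℕ → ℕ) : Fin n → ℕ := fun ℓ =>
  if (ℓ : ℕ) < ptil then (ℓ : ℕ)
  else 2 * (ℓ : ℕ) + 1 - ptil - εf ((ℓ : ℕ) - ptil)

section Antisymmetrization

variable {K : Type*} [CommRing K]

theorem sum_perm_fin_succ {n : ℕ} (G : Equiv.Perm (Fin (n + 1)) → K) :
    ∑ σ : Equiv.Perm (Fin (n + 1)), ((Equiv.Perm.sign σ : ℤ) : K) * G σ =
      ∑ k : Fin (n + 1), ((Equiv.Perm.sign (Equiv.swap 0 k) : ℤ) : K) *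
        ∑ e : Equiv.Perm (Fin n), ((Equiv.Perm.sign e : ℤ) : K) *
          G (Equiv.Perm.decomposeFin.symm (k, e)) := by
  rw [← Equiv.Perm.decomposeFin.symm.sum_comp, Fintype.sum_prod_type]
  refine Finset.sum_congr rfl fun k _ => ?_
  rw [Finset.mul_sum]
  refine Finset.sum_congr rfl fun e _ => ?_
  rw [Equiv.Perm.decomposeFin.symm_sign, Equiv.Perm.sign_swap']
  by_cases hk : k = 0
  · simp [hk]
  · simp [hk, Ne.symm hk]

theorem det_eq_sum_perm_fin_succ {n : ℕ} (M : Matrix (Fin (n + 1)) (Fin (n + 1)) K) :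
    M.det = ∑ k : Fin (n + 1), ((Equiv.Perm.sign (Equiv.swap 0 k) : ℤ) : K) *
      (M 0 k * (Matrix.of fun i j : Fin n => M i.succ (Equiv.swap 0 k j.succ)).det) := by
  rw [← Matrix.det_transpose, Matrix.det_apply', sum_perm_fin_succ]
  refine Finset.sum_congr rfl fun k _ => ?_
  rw [← Matrix.det_transpose (Matrix.of fun i j : Fin n => M i.succ (Equiv.swap 0 k j.succ)),
    Matrix.det_apply']
  congr 1
  rw [Finset.mul_sum]
  refine Finset.sum_congr rfl fun e _ => ?_
  rw [Fin.prod_univ_succ]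
  simp only [Matrix.transpose_apply, Matrix.of_apply, Equiv.Perm.decomposeFin_symm_apply_zero,
    Equiv.Perm.decomposeFin_symm_apply_succ]
  ring

/-- The row of products `∏ l, (a k - b l)` differs from the row of top powers by a combination of
the lower rows. -/
theorem det_cons_prod_sub {n : ℕ} (a b : Fin (n + 1) → K) :
    (Matrix.of (Fin.cons (fun k => ∏ l, (a k - b l))
      fun (i : Fin n) k => a k ^ (n - i : ℕ) - b k ^ (n - i : ℕ)) :
        Matrix (Fin (n + 1)) (Fin (n + 1)) K).det =
    (Matrix.of fun i k : Fin (n + 1) =>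
      a k ^ (n + 1 - i : ℕ) - b k ^ (n + 1 - i : ℕ)).det := by
  set B : Matrix (Fin (n + 1)) (Fin (n + 1)) K := Matrix.of fun i k : Fin (n + 1) =>
      a k ^ (n + 1 - i : ℕ) - b k ^ (n + 1 - i : ℕ) with hB
  set g : Polynomial K := ∏ l, (Polynomial.X - Polynomial.C (b l)) with hg
  have hmonic : g.Monic := Polynomial.monic_prod_of_monic _ _ fun l _ => Polynomial.monic_X_sub_C _
  have hdeg : g.natDegree ≤ n + 1 := by
    refine (Polynomial.natDegree_prod_le _ _).trans ?_
    refine (Finset.sum_le_card_nsmul _ _ 1 fun l _ => Polynomial.natDegree_X_sub_C_le _).trans ?_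
    simp
  have htop : g.coeff (n + 1) = 1 := by
    have := Polynomial.coeff_prod_of_natDegree_le (s := Finset.univ)
      (fun l : Fin (n + 1) => Polynomial.X - Polynomial.C (b l)) 1
      fun l _ => Polynomial.natDegree_X_sub_C_le _
    simpa [hg] using this
  have heval : ∀ x, g.eval x = ∑ i : Fin (n + 1), g.coeff (n + 1 - i) * x ^ (n + 1 - i : ℕ)
      + g.coeff 0 := by
    intro x
    rw [Polynomial.eval_eq_sum_range' (Nat.lt_succ_of_le hdeg), Finset.sum_range_succ',
      ← Finset.sum_range_reflect, Finset.sum_range]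
    simp only [pow_zero, mul_one, add_left_inj]
    refine Finset.sum_congr rfl fun i _ => ?_
    rw [show n + 1 - 1 - (i : ℕ) + 1 = n + 1 - i by omega]
  have hrow : ∀ k, ∏ l, (a k - b l) = ∑ i : Fin (n + 1), g.coeff (n + 1 - i) * B i k := by
    intro k
    have h1 : ∏ l, (a k - b l) = g.eval (a k) - g.eval (b k) := by
      rw [hg, Polynomial.eval_prod, Polynomial.eval_prod,
        Finset.prod_eq_zero (f := fun l => Polynomial.eval (b k) _) (Finset.mem_univ k) (by simp)]
      simp
    rw [h1, heval, heval, add_sub_add_right_eq_sub, ← Finset.sum_sub_distrib]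
    exact Finset.sum_congr rfl fun i _ => by simp [hB, mul_sub]
  have hupd := Matrix.det_updateRow_sum B 0 fun i => g.coeff (n + 1 - i)
  rw [Fin.val_zero, Nat.sub_zero, htop, one_smul] at hupd
  rw [← hupd]
  congr 1
  ext i k
  refine Fin.cases ?_ (fun i => ?_) i
  · simp [hrow, Finset.sum_apply]
  · rw [Matrix.updateRow_ne (Fin.succ_ne_zero i)]
    simp [hB]

theorem sum_sign_mul_prod_sub_eq_det_aux {n : ℕ} (a b : Fin n → K) :
    ∑ σ : Equiv.Perm (Fin n), ((Equiv.Perm.sign σ : ℤ) : K) *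
        ∏ m, ∏ l, (if m ≤ l then a (σ m) - b (σ l) else 1) =
      (Matrix.of fun i k : Fin n => a k ^ (n - i : ℕ) - b k ^ (n - i : ℕ)).det := by
  induction n with
  | zero => simp
  | succ n ih =>
    rw [sum_perm_fin_succ, ← det_cons_prod_sub, det_eq_sum_perm_fin_succ]
    refine Finset.sum_congr rfl fun k _ => ?_
    congr 1
    simp only [Matrix.of_apply, Fin.cons_zero, Fin.cons_succ]
    have ih' := ih (fun j => a (Equiv.swap 0 k j.succ)) fun j => b (Equiv.swap 0 k j.succ)
    rw [← ih', Finset.mul_sum]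
    refine Finset.sum_congr rfl fun e _ => ?_
    rw [Fin.prod_univ_succ]
    have h0 : ∏ l, (if (0 : Fin (n + 1)) ≤ l then
        a (Equiv.Perm.decomposeFin.symm (k, e) 0) - b (Equiv.Perm.decomposeFin.symm (k, e) l)
        else 1) = ∏ l, (a k - b l) := by
      simp only [Fin.zero_le, if_true, Equiv.Perm.decomposeFin_symm_apply_zero]
      exact Equiv.prod_comp (Equiv.Perm.decomposeFin.symm (k, e)) fun l => a k - b l
    rw [h0]
    have h1 : ∀ m : Fin n, ∏ l, (if m.succ ≤ l then
        a (Equiv.Perm.decomposeFin.symm (k, e) m.succ) - b (Equiv.Perm.decomposeFin.symm (k, e) l)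
        else 1) = ∏ l : Fin n, (if m ≤ l then
          a (Equiv.swap 0 k (e m).succ) - b (Equiv.swap 0 k (e l).succ) else 1) := by
      intro m
      rw [Fin.prod_univ_succ]
      simp [Equiv.Perm.decomposeFin_symm_apply_succ]
    simp only [h1]
    ring

/-- The antisymmetrization of `∏_{l ≤ m} (a_m - b_l)` is the determinant of the matrix of
differences of powers. -/
theorem sum_sign_mul_prod_sub_eq_det {n : ℕ} (a b : Fin n → K) :
    ∑ σ : Equiv.Perm (Fin n), ((Equiv.Perm.sign σ : ℤ) : K) *
        ∏ l, ∏ m, (if l ≤ m then a (σ m) - b (σ l) else 1) =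
      (Matrix.of fun i k : Fin n => a k ^ (i + 1 : ℕ) - b k ^ (i + 1 : ℕ)).det := by
  have hdet : (Matrix.of fun i k : Fin n => a k ^ (i + 1 : ℕ) - b k ^ (i + 1 : ℕ)) =
      (Matrix.of fun i k : Fin n => a k ^ (n - i : ℕ) - b k ^ (n - i : ℕ)).submatrix
        Fin.revPerm id := by
    ext i k
    have : n - (n - (i + 1 : ℕ)) = i + 1 := by omega
    simp [Fin.val_rev, this]
  rw [hdet, Matrix.det_permute, ← sum_sign_mul_prod_sub_eq_det_aux, Finset.mul_sum,
    ← Equiv.sum_comp (Equiv.mulRight Fin.revPerm)]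
  refine Finset.sum_congr rfl fun σ _ => ?_
  rw [Equiv.coe_mulRight, Equiv.Perm.sign_mul, mul_comm (Equiv.Perm.sign σ), Units.val_mul,
    Int.cast_mul, mul_assoc]
  congr 2
  rw [Finset.prod_comm, ← Equiv.prod_comp Fin.revPerm]
  refine Finset.prod_congr rfl fun m _ => ?_
  rw [← Equiv.prod_comp Fin.revPerm]
  exact Finset.prod_congr rfl fun l _ => by simp [Fin.rev_le_rev]

end Antisymmetrization

section MultivariateLaurent

variable {R : Type*} [CommRing R] {n : ℕ}

/-- The embedding of one-variable Laurent polynomials as the Laurent polynomials in the `m`-th of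
`n` variables. -/
noncomputable def laurentVar (m : Fin n) :
    LaurentPolynomial R →+* AddMonoidAlgebra R (Fin n → ℤ) :=
  AddMonoidAlgebra.mapDomainRingHom R (AddMonoidHom.single (fun _ : Fin n => ℤ) m)

theorem laurentVar_single (m : Fin n) (k : ℤ) (r : R) :
    laurentVar m (AddMonoidAlgebra.single k r) = AddMonoidAlgebra.single (Pi.single m k) r := by
  rw [laurentVar, AddMonoidAlgebra.mapDomainRingHom_apply, AddMonoidAlgebra.mapDomain_single]
  rfl

theorem coeff_prod_laurentVar (P : Fin n → LaurentPolynomial R) (κ : Fin n → ℤ) :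
    (∏ m, laurentVar m (P m)).coeff κ = ∏ m, (P m).coeff (κ m) := by
  classical
  have hP : ∀ m, laurentVar m (P m) = ∑ k ∈ (P m).coeff.support,
      (AddMonoidAlgebra.single (Pi.single m k) ((P m).coeff k) :
        AddMonoidAlgebra R (Fin n → ℤ)) := by
    intro m
    conv_lhs => rw [← AddMonoidAlgebra.sum_coeff_single (P m)]
    rw [Finsupp.sum, map_sum]
    exact Finset.sum_congr rfl fun k _ => laurentVar_single m k _
  simp only [hP]
  rw [Finset.prod_univ_sum, AddMonoidAlgebra.coeff_sum, Finsupp.finsetSum_apply]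
  simp only [AddMonoidAlgebra.prod_single, Finset.univ_sum_single,
    AddMonoidAlgebra.coeff_single, Finsupp.single_apply]
  rw [Finset.sum_ite_eq']
  split_ifs with h
  · rfl
  · simp only [Fintype.mem_piFinset, not_forall, Finsupp.mem_support_iff, not_not] at h
    obtain ⟨m, hm⟩ := h
    exact (Finset.prod_eq_zero (Finset.mem_univ m) hm).symm

/-- The action of a permutation of the variables on Laurent polynomials. -/
noncomputable def permuteVars (σ : Equiv.Perm (Fin n)) :
    AddMonoidAlgebra R (Fin n → ℤ) ≃ₐ[R] AddMonoidAlgebra R (Fin n → ℤ) :=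
  AddMonoidAlgebra.domCongr R R
    { Equiv.arrowCongr σ (Equiv.refl ℤ) with map_add' := fun _ _ => rfl }

theorem coeff_zero_permuteVars (σ : Equiv.Perm (Fin n)) (x : AddMonoidAlgebra R (Fin n → ℤ)) :
    (permuteVars σ x).coeff 0 = x.coeff 0 := by
  rw [permuteVars, AddMonoidAlgebra.coeff_domCongr]
  congr 1

theorem permuteVars_laurentVar (σ : Equiv.Perm (Fin n)) (m : Fin n) (P : LaurentPolynomial R) :
    permuteVars σ (laurentVar m P) = laurentVar (σ m) P := by
  conv_lhs => rw [← AddMonoidAlgebra.sum_coeff_single P]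
  conv_rhs => rw [← AddMonoidAlgebra.sum_coeff_single P]
  simp only [Finsupp.sum, map_sum, laurentVar_single]
  refine Finset.sum_congr rfl fun k _ => ?_
  rw [permuteVars, AddMonoidAlgebra.domCongr_single]
  congr 1
  ext j
  change (Pi.single m k : Fin n → ℤ) (σ.symm j) = _
  simp [Pi.single_apply, Equiv.symm_apply_eq]

theorem sum_sum_sign_mul_prod (M : Matrix (Fin n) (Fin n) R) :
    ∑ ρ : Equiv.Perm (Fin n), ∑ σ : Equiv.Perm (Fin n), ((Equiv.Perm.sign ρ : ℤ) : R) *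
      (((Equiv.Perm.sign σ : ℤ) : R) * ∏ k, M (ρ k) (σ k)) = (n.factorial : R) * M.det := by
  rw [Finset.sum_comm]
  have h : ∀ σ : Equiv.Perm (Fin n), ∑ ρ : Equiv.Perm (Fin n), ((Equiv.Perm.sign ρ : ℤ) : R) *
      (((Equiv.Perm.sign σ : ℤ) : R) * ∏ k, M (ρ k) (σ k)) = M.det := by
    intro σ
    have h1 := Matrix.det_permute' σ M
    rw [Matrix.det_apply'] at h1
    simp only [mul_left_comm _ ((Equiv.Perm.sign σ : ℤ) : R)]
    rw [← Finset.mul_sum]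
    simp only [Matrix.submatrix_apply, id] at h1
    rw [h1, ← mul_assoc, ← Int.cast_mul, ← Units.val_mul, Int.units_mul_self]
    simp
  simp [h, Fintype.card_perm]

/-- The constant-term identity behind the sum rule: in an antisymmetric constant term, the factor
`∏_{l ≤ m} (α_m - β_l)` may be replaced by `∏_m α_m ^ m`, provided multiplying `γ` by powers of `β`
kills the constant term. -/
theorem constantTerm_eq_det [IsDomain R] [CharZero R] (γ α β : LaurentPolynomial R)
    (h : ∀ i, (γ * β ^ i).coeff 0 = 0) :
    ((∏ m : Fin n, laurentVar m γ) *
      (∏ l : Fin n, ∏ m : Fin n, if l < m then laurentVar m β - laurentVar l β else 1) *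
      ∏ l : Fin n, ∏ m : Fin n, if l ≤ m then laurentVar m α - laurentVar l β else 1).coeff 0 =
    (Matrix.of fun i j : Fin n => (γ * β ^ (i : ℕ) * α ^ (j + 1 : ℕ)).coeff 0).det := by
  set V := (Matrix.vandermonde fun m : Fin n => laurentVar m β).det with hV
  have hV' : (∏ l : Fin n, ∏ m : Fin n, if l < m then laurentVar m β - laurentVar l β else 1) =
      V := by
    rw [hV, Matrix.det_vandermonde]
    refine Finset.prod_congr rfl fun l _ => ?_
    rw [Finset.prod_ite, Finset.prod_const_one, mul_one]
    refine Finset.prod_congr ?_ fun _ _ => rfl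
    ext; simp
  rw [hV']
  set W := (∏ m : Fin n, laurentVar m γ) * V with hW
  have hperm : ∀ σ : Equiv.Perm (Fin n),
      permuteVars σ W = ((Equiv.Perm.sign σ : ℤ) : AddMonoidAlgebra R (Fin n → ℤ)) * W := by
    intro σ
    have h1 : permuteVars σ (∏ m : Fin n, laurentVar m γ) = ∏ m : Fin n, laurentVar m γ := by
      rw [map_prod]
      simp only [permuteVars_laurentVar]
      exact Equiv.prod_comp σ fun m => laurentVar m γ
    have h2 : permuteVars σ V = ((Equiv.Perm.sign σ : ℤ) : AddMonoidAlgebra R (Fin n → ℤ)) * V := by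
      rw [hV, ← Matrix.det_permute, AlgEquiv.map_det]
      congr 1
      ext i j : 2
      simp [Matrix.vandermonde_apply, permuteVars_laurentVar]
    rw [hW, map_mul, h1, h2]
    ring
  set B := ∏ l : Fin n, ∏ m : Fin n, (if l ≤ m then laurentVar m α - laurentVar l β else 1) with hB
  have hBperm : ∀ σ : Equiv.Perm (Fin n), permuteVars σ B = ∏ l : Fin n, ∏ m : Fin n,
      (if l ≤ m then laurentVar (σ m) α - laurentVar (σ l) β else 1) := by
    intro σ
    rw [hB]
    simp only [map_prod]
    refine Finset.prod_congr rfl fun l _ => Finset.prod_congr rfl fun m _ => ?_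
    split_ifs <;> simp [permuteVars_laurentVar]
  have hsum : ∑ σ : Equiv.Perm (Fin n), permuteVars σ (W * B) =
      W * (Matrix.of fun i k : Fin n =>
        laurentVar k α ^ (i + 1 : ℕ) - laurentVar k β ^ (i + 1 : ℕ)).det := by
    rw [← sum_sign_mul_prod_sub_eq_det, Finset.mul_sum]
    refine Finset.sum_congr rfl fun σ _ => ?_
    rw [map_mul, hperm, hBperm]
    ring
  have hexp : W * (Matrix.of fun i k : Fin n =>
        laurentVar k α ^ (i + 1 : ℕ) - laurentVar k β ^ (i + 1 : ℕ)).det =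
      ∑ ρ : Equiv.Perm (Fin n), ∑ σ : Equiv.Perm (Fin n),
        ((Equiv.Perm.sign ρ : ℤ) : R) • (((Equiv.Perm.sign σ : ℤ) : R) •
          ∏ k, laurentVar k
            (γ * β ^ (ρ k : ℕ) * (α ^ (σ k + 1 : ℕ) - β ^ (σ k + 1 : ℕ)))) := by
    rw [hW, hV, ← Matrix.det_transpose, Matrix.det_apply', Matrix.det_apply', mul_assoc,
      Finset.sum_mul_sum, Finset.mul_sum]
    refine Finset.sum_congr rfl fun ρ _ => ?_
    rw [Finset.mul_sum]
    refine Finset.sum_congr rfl fun σ _ => ?_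
    simp only [map_mul, Finset.prod_mul_distrib, map_sub, map_pow, Matrix.transpose_apply,
      Matrix.vandermonde_apply, Matrix.of_apply, Int.cast_smul_eq_zsmul, zsmul_eq_mul]
    ring
  have hfact : (n.factorial : R) * (W * B).coeff 0 = (n.factorial : R) *
      (Matrix.of fun i j : Fin n => (γ * β ^ (i : ℕ) * α ^ (j + 1 : ℕ)).coeff 0).det := by
    rw [← sum_sum_sign_mul_prod]
    trans (∑ σ : Equiv.Perm (Fin n), permuteVars σ (W * B)).coeff 0
    · rw [AddMonoidAlgebra.coeff_sum, Finsupp.finsetSum_apply]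
      simp only [coeff_zero_permuteVars]
      simp [Fintype.card_perm]
    · rw [hsum, hexp]
      simp only [AddMonoidAlgebra.coeff_sum, Finsupp.finsetSum_apply,
        AddMonoidAlgebra.coeff_smul, Finsupp.smul_apply, coeff_prod_laurentVar, smul_eq_mul,
        Pi.zero_apply, Matrix.of_apply]
      refine Finset.sum_congr rfl fun ρ _ => Finset.sum_congr rfl fun σ _ => ?_
      congr 2
      refine Finset.prod_congr rfl fun k _ => ?_
      rw [mul_sub, AddMonoidAlgebra.coeff_sub, Finsupp.sub_apply,
        mul_assoc γ (β ^ (ρ k : ℕ)) (β ^ _),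
        ← pow_add, h, sub_zero]
  exact mul_left_cancel₀ (Nat.cast_ne_zero.mpr n.factorial_ne_zero) hfact

end MultivariateLaurent

section ConstantTermOfFodd

theorem coeff_toLaurent_mul_T_neg {R : Type*} [CommRing R] (P : Polynomial R) (k : ℕ) :
    (Polynomial.toLaurent P * LaurentPolynomial.T (-(k : ℤ))).coeff 0 = P.coeff k := by
  induction P using Polynomial.induction_on' with
  | add p q hp hq => 
    rw [map_add, add_mul, AddMonoidAlgebra.coeff_add, Finsupp.add_apply, hp, hq,
      Polynomial.coeff_add]
  | monomial i c =>
    rw [← Polynomial.C_mul_X_pow_eq_monomial, Polynomial.toLaurent_C_mul_X_pow, mul_assoc,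
      ← LaurentPolynomial.T_add, ← LaurentPolynomial.single_eq_C_mul_T,
      AddMonoidAlgebra.coeff_single, Finsupp.single_apply, Polynomial.coeff_C_mul_X_pow]
    refine if_congr ?_ rfl rfl
    omega

theorem coeff_zero_mul_T_neg_two_mul_pow {R : Type*} [CommRing R] (P Q S : Polynomial R)
    (i j : ℕ) :
    (LaurentPolynomial.T 1 * Polynomial.toLaurent P * Polynomial.toLaurent Q ^ i *
      (LaurentPolynomial.T (-2) * Polynomial.toLaurent S) ^ (j + 1)).coeff 0 =
    (P * Q ^ i * S ^ (j + 1)).coeff (2 * j + 1) := by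
  rw [← coeff_toLaurent_mul_T_neg, mul_pow, LaurentPolynomial.T_pow, map_mul, map_mul, map_pow,
    map_pow, show -((2 * j + 1 : ℕ) : ℤ) = 1 + ((j + 1 : ℕ) : ℤ) * (-2) by push_cast; ring,
    LaurentPolynomial.T_add]
  congr 2
  ring

theorem laurentVar_pow_mul {R : Type*} [CommRing R] {n : ℕ} (m : Fin n) (k : ℕ)
    (g : Polynomial R) :
    laurentVar m (LaurentPolynomial.T 1) ^ (2 * k + 2) *
      (laurentVar m (Polynomial.toLaurent g) *
        laurentVar m (LaurentPolynomial.T (-((2 * k + 1 : ℕ) : ℤ)))) =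
      laurentVar m (LaurentPolynomial.T 1 * Polynomial.toLaurent g) := by
  rw [← map_pow, LaurentPolynomial.T_pow, ← map_mul, ← map_mul]
  congr 1
  rw [mul_left_comm, ← LaurentPolynomial.T_add, mul_comm]
  congr 2
  push_cast
  ring

/-- The inclusion of polynomials into Laurent polynomials in `n` variables. -/
noncomputable def toMultiLaurent {R : Type*} [CommRing R] (n : ℕ) :
    MvPolynomial (Fin n) R →+* AddMonoidAlgebra R (Fin n → ℤ) :=
  MvPolynomial.eval₂Hom AddMonoidAlgebra.singleZeroRingHom
    fun m => laurentVar m (LaurentPolynomial.T 1)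

theorem laurentVar_C {R : Type*} [CommRing R] {n : ℕ} (m : Fin n) (r : R) :
    laurentVar m (LaurentPolynomial.C r) = AddMonoidAlgebra.singleZeroRingHom r := by
  rw [← LaurentPolynomial.single_eq_C, laurentVar_single, Pi.single_zero]
  rfl

theorem coeff_eq_coeff_zero_toMultiLaurent {R : Type*} [CommRing R] {n : ℕ}
    (P : MvPolynomial (Fin n) R) (e : Fin n → ℕ) :
    (toMultiLaurent n P * ∏ m, laurentVar m (LaurentPolynomial.T (-(e m : ℤ)))).coeff 0 =
      P.coeff (Finsupp.equivFunOnFinite.symm e) := by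
  classical
  induction P using MvPolynomial.induction_on' with
  | add p q hp hq =>
    rw [map_add, add_mul, AddMonoidAlgebra.coeff_add, Finsupp.add_apply, hp, hq,
      MvPolynomial.coeff_add]
  | monomial s c =>
    have h1 : toMultiLaurent n (MvPolynomial.monomial s c) *
        ∏ m, laurentVar m (LaurentPolynomial.T (-(e m : ℤ))) =
        c • ∏ m, laurentVar m (LaurentPolynomial.T ((s m : ℤ) - e m)) := by
      rw [toMultiLaurent, MvPolynomial.coe_eval₂Hom, MvPolynomial.eval₂_monomial,
        Finsupp.prod_fintype _ _ (by simp), mul_assoc, ← Finset.prod_mul_distrib,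
        Algebra.smul_def]
      congr 1
      refine Finset.prod_congr rfl fun m _ => ?_
      rw [← map_pow, LaurentPolynomial.T_pow, ← map_mul, ← LaurentPolynomial.T_add, mul_one,
        sub_eq_add_neg]
    rw [h1, AddMonoidAlgebra.coeff_smul, Finsupp.smul_apply, coeff_prod_laurentVar,
      MvPolynomial.coeff_monomial]
    simp only [LaurentPolynomial.T_apply, Pi.zero_apply, smul_eq_mul, sub_eq_zero, Nat.cast_inj]
    rw [Finset.prod_ite_zero]
    by_cases h : s = Finsupp.equivFunOnFinite.symm e
    · subst h; simp
    · rw [if_neg h, if_neg, mul_zero]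
      exact fun h' => h (Finsupp.ext fun m => h' m (Finset.mem_univ m))

/-- The Vandermonde variable `u ↦ u (τ + u)`. -/
noncomputable def quadVar : Polynomial (Polynomial ℤ) :=
  Polynomial.X * (Polynomial.C Polynomial.X + Polynomial.X)

theorem toMultiLaurent_aeval {R : Type*} [CommRing R] {n : ℕ} (g : Polynomial R) (m : Fin n) :
    toMultiLaurent n (Polynomial.aeval (MvPolynomial.X m) g) =
      laurentVar m (Polynomial.toLaurent g) := by
  induction g using Polynomial.induction_on' with
  | add p q hp hq => simp only [map_add, hp, hq]
  | monomial i c =>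
    rw [Polynomial.aeval_monomial, ← Polynomial.C_mul_X_pow_eq_monomial,
      Polynomial.toLaurent_C_mul_X_pow, map_mul, map_mul, laurentVar_C, map_pow,
      toMultiLaurent, MvPolynomial.eval₂Hom_X', MvPolynomial.algebraMap_eq,
      MvPolynomial.eval₂Hom_C, ← map_pow, LaurentPolynomial.T_pow, mul_one]

theorem coeff_Fodd_mul_prod (n : ℕ) (g : Polynomial (Polynomial ℤ)) :
    (Fodd n * ∏ m, Polynomial.aeval (MvPolynomial.X m) g).coeff
        (Finsupp.equivFunOnFinite.symm fun m : Fin n => 2 * (m : ℕ) + 1) =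
      (Matrix.of fun i j : Fin n =>
        (g * quadVar ^ (i : ℕ) *
          (1 + Polynomial.C Polynomial.X * Polynomial.X) ^ (j + 1 : ℕ)).coeff
            (2 * (j : ℕ) + 1)).det := by
  set γ : LaurentPolynomial (Polynomial ℤ) := LaurentPolynomial.T 1 * Polynomial.toLaurent g with hγ
  set β : LaurentPolynomial (Polynomial ℤ) := Polynomial.toLaurent quadVar with hβ
  set α : LaurentPolynomial (Polynomial ℤ) := LaurentPolynomial.T (-1) *
    (LaurentPolynomial.C Polynomial.X + LaurentPolynomial.T (-1)) with hα
  have hβ' : β = LaurentPolynomial.T 1 * (LaurentPolynomial.C Polynomial.X +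
      LaurentPolynomial.T 1) := by
    simp [hβ, quadVar]
  have hα' : α = LaurentPolynomial.T (-2) * Polynomial.toLaurent
      (1 + Polynomial.C Polynomial.X * Polynomial.X) := by
    have h1 : (LaurentPolynomial.T (-1) : LaurentPolynomial (Polynomial ℤ)) =
        LaurentPolynomial.T (-2) * LaurentPolynomial.T 1 := by
      rw [← LaurentPolynomial.T_add]; rfl
    have h2 : (LaurentPolynomial.T (-2) : LaurentPolynomial (Polynomial ℤ)) =
        LaurentPolynomial.T (-1) * LaurentPolynomial.T (-1) := by
      rw [← LaurentPolynomial.T_add]; rfl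
    simp only [map_add, map_one, map_mul, Polynomial.toLaurent_C, Polynomial.toLaurent_X]
    linear_combination LaurentPolynomial.C Polynomial.X * h1 - h2
  have h0 : ∀ i, (γ * β ^ i).coeff 0 = 0 := by
    intro i
    have := coeff_toLaurent_mul_T_neg (Polynomial.X * g * quadVar ^ i) 0
    simpa [hγ, hβ, mul_assoc] using this
  have hct := constantTerm_eq_det (n := n) γ α β h0
  have hentry : ∀ i j : ℕ, (γ * β ^ i * α ^ (j + 1)).coeff 0 =
      (g * quadVar ^ i * (1 + Polynomial.C Polynomial.X * Polynomial.X) ^ (j + 1)).coeff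
        (2 * j + 1) := by
    intro i j
    rw [hα', hβ, hγ, coeff_zero_mul_T_neg_two_mul_pow]
  simp only [hentry] at hct
  rw [← hct, ← coeff_eq_coeff_zero_toMultiLaurent]
  congr 2
  set u : Fin n → AddMonoidAlgebra (Polynomial ℤ) (Fin n → ℤ) :=
    fun m => laurentVar m (LaurentPolynomial.T 1) with hu
  set v : Fin n → AddMonoidAlgebra (Polynomial ℤ) (Fin n → ℤ) :=
    fun m => laurentVar m (LaurentPolynomial.T (-1)) with hv
  have huv : ∀ m, u m * v m = 1 := by
    intro m
    rw [hu, hv, ← map_mul, ← LaurentPolynomial.T_add]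
    simp
  set t : AddMonoidAlgebra (Polynomial ℤ) (Fin n → ℤ) :=
    AddMonoidAlgebra.singleZeroRingHom Polynomial.X with ht
  have hX : ∀ m, toMultiLaurent n (MvPolynomial.X m : MvPolynomial (Fin n) (Polynomial ℤ)) = u m :=
    fun m => MvPolynomial.eval₂Hom_X' ..
  have hC : toMultiLaurent n (MvPolynomial.C Polynomial.X) = t := MvPolynomial.eval₂Hom_C ..
  have hαv : ∀ m, laurentVar m α = v m * (t + v m) := by
    intro m
    rw [hα, map_mul, map_add, laurentVar_C]
  have hβu : ∀ m, laurentVar m β = u m * (t + u m) := by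
    intro m
    rw [hβ', map_mul, map_add, laurentVar_C]
  have hsq : ∏ l : Fin n, ∏ m : Fin n, (if l ≤ m then u m ^ 2 else 1) =
      ∏ m : Fin n, u m ^ (2 * (m : ℕ) + 2) := by
    rw [Finset.prod_comm]
    refine Finset.prod_congr rfl fun m _ => ?_
    rw [Finset.prod_ite, Finset.prod_const_one, mul_one, Finset.prod_const, ← pow_mul]
    congr 1
    have : Finset.univ.filter (fun l : Fin n => l ≤ m) = Finset.Iic m := by ext; simp
    rw [this, Fin.card_Iic]
    ring
  have hleft : toMultiLaurent n (∏ l : Fin n, ∏ m : Fin n, if l ≤ m then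
        (1 - MvPolynomial.X l * MvPolynomial.X m) *
          (1 + MvPolynomial.C Polynomial.X * MvPolynomial.X m +
            MvPolynomial.X l * MvPolynomial.X m) else 1) =
      (∏ m : Fin n, u m ^ (2 * (m : ℕ) + 2)) *
        ∏ l : Fin n, ∏ m : Fin n, if l ≤ m then laurentVar m α - laurentVar l β else 1 := by
    rw [← hsq, ← Finset.prod_mul_distrib, map_prod]
    refine Finset.prod_congr rfl fun l _ => ?_
    rw [← Finset.prod_mul_distrib, map_prod]
    refine Finset.prod_congr rfl fun m _ => ?_
    split_ifs
    · simp only [map_mul, map_add, map_sub, map_one, hX, hC, hαv, hβu]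
      linear_combination (-(t * u m) - u m * v m - 1) * huv m
    · simp
  have hright : toMultiLaurent n (∏ l : Fin n, ∏ m : Fin n, if l < m then
        (MvPolynomial.X m - MvPolynomial.X l) *
          (MvPolynomial.C Polynomial.X + MvPolynomial.X l + MvPolynomial.X m) else 1) =
        ∏ l : Fin n, ∏ m : Fin n, if l < m then laurentVar m β - laurentVar l β else 1 := by
    rw [map_prod]
    refine Finset.prod_congr rfl fun l _ => ?_
    rw [map_prod]
    refine Finset.prod_congr rfl fun m _ => ?_
    split_ifs
    · simp only [map_mul, map_add, map_sub, hX, hC, hβu]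
      ring
    · simp
  have hmono : (∏ m : Fin n, u m ^ (2 * (m : ℕ) + 2)) *
      ((∏ m, laurentVar m (Polynomial.toLaurent g)) *
        ∏ m : Fin n, laurentVar m (LaurentPolynomial.T (-((2 * (m : ℕ) + 1 : ℕ) : ℤ)))) =
      ∏ m : Fin n, laurentVar m γ := by
    rw [← Finset.prod_mul_distrib, ← Finset.prod_mul_distrib]
    refine Finset.prod_congr rfl fun m _ => ?_
    exact laurentVar_pow_mul m (m : ℕ) g
  rw [Fodd, map_mul, map_mul, hleft, hright, map_prod, ← hmono]
  simp only [toMultiLaurent_aeval]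
  ring

end ConstantTermOfFodd

section Reduction

theorem coeff_cons_zero {R : Type*} [CommRing R] {n : ℕ} (P : MvPolynomial (Fin (n + 1)) R)
    (e : Fin n → ℕ) :
    P.coeff (Finsupp.equivFunOnFinite.symm (Fin.cons 0 e : Fin (n + 1) → ℕ)) =
      (MvPolynomial.aeval (Fin.cons 0 MvPolynomial.X : Fin (n + 1) → MvPolynomial (Fin n) R)
        P).coeff (Finsupp.equivFunOnFinite.symm e) := by
  have h1 : (MvPolynomial.aeval (Fin.cons 0 MvPolynomial.X :
      Fin (n + 1) → MvPolynomial (Fin n) R) P) = (MvPolynomial.finSuccEquiv R n P).coeff 0 := by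
    rw [← Polynomial.constantCoeff_apply]
    induction P using MvPolynomial.induction_on with
    | C r => simp [MvPolynomial.finSuccEquiv_apply]
    | add p q hp hq => simp only [map_add, hp, hq]
    | mul_X p i hp =>
      rw [map_mul, hp, map_mul, map_mul]
      congr 1
      refine Fin.cases ?_ (fun i => ?_) i
      · simp [MvPolynomial.finSuccEquiv_X_zero]
      · simp [MvPolynomial.finSuccEquiv_X_succ]
  rw [h1, MvPolynomial.finSuccEquiv_coeff_coeff]
  congr 1

theorem aeval_cons_zero_Fodd (n : ℕ) :
    MvPolynomial.aeval (Fin.cons 0 MvPolynomial.X :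
        Fin (n + 1) → MvPolynomial (Fin n) (Polynomial ℤ)) (Fodd (n + 1)) =
      Fodd n * (∏ m, (MvPolynomial.C Polynomial.X + MvPolynomial.X m) *
        (1 + MvPolynomial.C Polynomial.X * MvPolynomial.X m)) * ∏ m, MvPolynomial.X m := by
  have hite : ∀ {n : ℕ} (q : Prop) [Decidable q] (x : MvPolynomial (Fin (n + 1)) (Polynomial ℤ))
      (f : Fin (n + 1) → MvPolynomial (Fin n) (Polynomial ℤ)),
      MvPolynomial.aeval f (if q then x else 1) = if q then MvPolynomial.aeval f x else 1 := by
    intro n q _ x f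
    split_ifs <;> simp
  rw [Fodd, Fodd, map_mul]
  simp only [map_prod, hite, map_mul, map_sub, map_add, map_one, MvPolynomial.aeval_X,
    MvPolynomial.algHom_C, MvPolynomial.algebraMap_eq]
  simp only [Fin.prod_univ_succ, Fin.cons_zero, Fin.cons_succ, Fin.zero_le, if_true,
    Fin.succ_le_succ_iff, Fin.succ_lt_succ_iff, Fin.succ_pos, if_false,
    Fin.le_zero_iff, Fin.succ_ne_zero, Fin.not_lt_zero, zero_mul, mul_zero, sub_zero, add_zero,
    one_mul, mul_one, Finset.prod_mul_distrib, Finset.prod_const_one]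
  ring

/-- Since the first `k` exponents are `0, 1, …, k - 1`, setting the corresponding variables to zero
one after the other reduces a coefficient of `Fodd (p + k)` to one of `Fodd p`. -/
theorem coeff_Fodd_add (p k : ℕ) (g : Polynomial (Polynomial ℤ)) (e : ℕ → ℕ) :
    (Fodd (p + k) * ∏ m, Polynomial.aeval (MvPolynomial.X m) g).coeff
        (Finsupp.equivFunOnFinite.symm fun l : Fin (p + k) =>
          if (l : ℕ) < k then (l : ℕ) else e (l - k) + k) =
      g.coeff 0 ^ k * Polynomial.X ^ (k * (k - 1) / 2) *
        (Fodd p * ∏ m, Polynomial.aeval (MvPolynomial.X m)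
          (g * ((Polynomial.C Polynomial.X + Polynomial.X) *
            (1 + Polynomial.C Polynomial.X * Polynomial.X)) ^ k)).coeff
          (Finsupp.equivFunOnFinite.symm fun l : Fin p => e l) := by
  induction k generalizing g with
  | zero => simp
  | succ k ih =>
    change (Fodd (p + k + 1) * ∏ m : Fin (p + k + 1), Polynomial.aeval (MvPolynomial.X m :
      MvPolynomial (Fin (p + k + 1)) (Polynomial ℤ)) g).coeff
        (Finsupp.equivFunOnFinite.symm fun l : Fin (p + k + 1) =>
          if (l : ℕ) < k + 1 then (l : ℕ) else e (l - (k + 1)) + (k + 1)) = _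
    have hcons : (fun l : Fin (p + k + 1) => if (l : ℕ) < k + 1 then (l : ℕ)
        else e (l - (k + 1)) + (k + 1)) = (Fin.cons 0 (fun l : Fin (p + k) =>
          (if (l : ℕ) < k then (l : ℕ) else e (l - k) + k) + 1) : Fin (p + k + 1) → ℕ) := by
      ext l
      refine Fin.cases ?_ (fun l => ?_) l
      · simp
      · simp only [Fin.cons_succ, Fin.val_succ, Nat.add_lt_add_iff_right, Nat.add_sub_add_right]
        split_ifs <;> ring
    have hshift : (Finsupp.equivFunOnFinite.symm fun l : Fin (p + k) =>
          (if (l : ℕ) < k then (l : ℕ) else e (l - k) + k) + 1) =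
        (Finsupp.equivFunOnFinite.symm fun l : Fin (p + k) =>
          (if (l : ℕ) < k then (l : ℕ) else e (l - k) + k)) +
          Finsupp.equivFunOnFinite.symm fun _ => 1 := by
      ext l; simp
    have hX : (∏ m : Fin (p + k), MvPolynomial.X m : MvPolynomial (Fin (p + k)) (Polynomial ℤ)) =
        MvPolynomial.monomial (Finsupp.equivFunOnFinite.symm fun _ => 1) 1 := by
      rw [MvPolynomial.monomial_eq, Finsupp.prod_fintype _ _ (by simp)]
      simp
    have hprod : MvPolynomial.aeval (Fin.cons 0 MvPolynomial.X :
        Fin (p + k + 1) → MvPolynomial (Fin (p + k)) (Polynomial ℤ))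
        (∏ m : Fin (p + k + 1), Polynomial.aeval (MvPolynomial.X m :
          MvPolynomial (Fin (p + k + 1)) (Polynomial ℤ)) g) =
          MvPolynomial.C (g.coeff 0) *
            ∏ m : Fin (p + k), Polynomial.aeval (MvPolynomial.X m) g := by
      rw [map_prod, Fin.prod_univ_succ]
      have hcomp : ∀ m : Fin (p + k + 1), MvPolynomial.aeval (Fin.cons 0 MvPolynomial.X :
          Fin (p + k + 1) → MvPolynomial (Fin (p + k)) (Polynomial ℤ))
          (Polynomial.aeval (MvPolynomial.X m) g) = Polynomial.aeval ((Fin.cons 0 MvPolynomial.X :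
          Fin (p + k + 1) → MvPolynomial (Fin (p + k)) (Polynomial ℤ)) m) g := fun m => by
        rw [← Polynomial.aeval_algHom_apply, MvPolynomial.aeval_X]
      simp only [hcomp, Fin.cons_zero, Fin.cons_succ]
      rw [← Polynomial.coeff_zero_eq_aeval_zero', MvPolynomial.algebraMap_eq]
    have hmul : ∀ m : Fin (p + k), Polynomial.aeval (MvPolynomial.X m :
          MvPolynomial (Fin (p + k)) (Polynomial ℤ))
        (g * ((Polynomial.C Polynomial.X + Polynomial.X) *
            (1 + Polynomial.C Polynomial.X * Polynomial.X))) =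
        Polynomial.aeval (MvPolynomial.X m) g * ((MvPolynomial.C Polynomial.X + MvPolynomial.X m) *
          (1 + MvPolynomial.C Polynomial.X * MvPolynomial.X m)) := by
      intro m
      simp [MvPolynomial.algebraMap_eq]
    have hih := ih (g * ((Polynomial.C Polynomial.X + Polynomial.X) *
            (1 + Polynomial.C Polynomial.X * Polynomial.X)))
    simp only [hmul, Finset.prod_mul_distrib (f := fun m => Polynomial.aeval _ g)] at hih
    rw [hcons, coeff_cons_zero (n := p + k), map_mul, aeval_cons_zero_Fodd, hprod, hshift, hX,
      show ∀ F A M c G : MvPolynomial (Fin (p + k)) (Polynomial ℤ),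
        F * A * M * (c * G) = c * (F * (G * A) * M) from fun F A M c G => by ring,
      MvPolynomial.coeff_C_mul, MvPolynomial.coeff_mul_monomial, mul_one, hih]
    have h0 : (g * ((Polynomial.C Polynomial.X + Polynomial.X) *
        (1 + Polynomial.C Polynomial.X * Polynomial.X))).coeff 0 = g.coeff 0 * Polynomial.X := by
      simp [Polynomial.mul_coeff_zero]
    have htri : (k + 1) * (k + 1 - 1) / 2 = k + k * (k - 1) / 2 := by
      rw [← Finset.sum_range_id, ← Finset.sum_range_id, Finset.sum_range_succ, add_comm]
    rw [h0, htri, mul_assoc g, ← pow_succ', pow_add, mul_pow, pow_succ (g.coeff 0)]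
    ring

end Reduction

section Assembly

theorem monomial_one_finset_prod {R : Type*} [CommRing R] {p : ℕ} (ε : Fin p → Fin 2)
    (c : Fin 2 → R) :
    ∏ j, (MvPolynomial.C (c (ε j)) * MvPolynomial.X j ^ (ε j : ℕ) : MvPolynomial (Fin p) R) =
      MvPolynomial.monomial (Finsupp.equivFunOnFinite.symm fun j => (ε j : ℕ)) (∏ j, c (ε j)) := by
  rw [MvPolynomial.monomial_eq, Finsupp.prod_fintype _ _ (by simp), Finset.prod_mul_distrib,
    map_prod]
  simp

theorem sum_prod_mul_coeff_sub {R : Type*} [CommRing R] {p : ℕ} (H : MvPolynomial (Fin p) R)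
    (c : Fin 2 → R) :
    ∑ ε : Fin p → Fin 2, (∏ j, c (ε j)) *
        H.coeff (Finsupp.equivFunOnFinite.symm fun j : Fin p => 2 * (j : ℕ) + 1 - (ε j : ℕ)) =
      (H * ∏ j, Polynomial.aeval (MvPolynomial.X j)
        (Polynomial.C (c 0) + Polynomial.C (c 1) * Polynomial.X)).coeff
        (Finsupp.equivFunOnFinite.symm fun j : Fin p => 2 * (j : ℕ) + 1) := by
  have hfac : ∀ j : Fin p, Polynomial.aeval (MvPolynomial.X j : MvPolynomial (Fin p) R)
      (Polynomial.C (c 0) + Polynomial.C (c 1) * Polynomial.X) =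
      ∑ a : Fin 2, MvPolynomial.C (c a) * MvPolynomial.X j ^ (a : ℕ) := by
    intro j
    simp [Fin.sum_univ_two, MvPolynomial.algebraMap_eq]
  simp only [hfac]
  rw [Finset.prod_univ_sum, Fintype.piFinset_univ, Finset.mul_sum, MvPolynomial.coeff_sum]
  refine Finset.sum_congr rfl fun ε _ => ?_
  have hsplit : (Finsupp.equivFunOnFinite.symm fun j : Fin p => 2 * (j : ℕ) + 1) =
      (Finsupp.equivFunOnFinite.symm fun j : Fin p => 2 * (j : ℕ) + 1 - (ε j : ℕ)) +
        Finsupp.equivFunOnFinite.symm fun j => (ε j : ℕ) := by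
    ext j
    simp only [Finsupp.coe_add, Pi.add_apply, Finsupp.equivFunOnFinite_symm_apply_apply]
    have := (ε j).isLt
    omega
  rw [monomial_one_finset_prod, hsplit, MvPolynomial.coeff_mul_monomial, mul_comm]

theorem coeff_one_add_C_mul_X_pow {R : Type*} [CommRing R] (t : R) (b y : ℕ) :
    ((1 + Polynomial.C t * Polynomial.X) ^ b).coeff y = (b.choose y : R) * t ^ y := by
  have h : (1 + Polynomial.C t * Polynomial.X) ^ b =
      (((1 + Polynomial.X) ^ b : Polynomial R)).comp (Polynomial.C t * Polynomial.X) := by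
    simp
  rw [h, Polynomial.comp_C_mul_X_coeff, Polynomial.coeff_one_add_X_pow]

theorem X_pow_mul_coeff_two_mul_add_one (p i j a b : ℕ) (hj : j < p) :
    (Polynomial.X : Polynomial ℤ) ^ (2 * j + 1) *
        (Polynomial.X ^ i * (Polynomial.C Polynomial.X + Polynomial.X) ^ a *
          (1 + Polynomial.C Polynomial.X * Polynomial.X) ^ b :
            Polynomial (Polynomial ℤ)).coeff (2 * j + 1) =
      Polynomial.X ^ (a + i) * ∑ r ∈ Finset.range (2 * p + 1),
        Polynomial.C (intChoose (a : ℤ) ((r : ℤ) - ((i : ℤ) + 1)) *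
            intChoose (b : ℤ) (2 * ((j : ℤ) + 1) - (r : ℤ))) *
          Polynomial.X ^ (2 * (2 * ((j : ℤ) + 1) - (r : ℤ))).toNat := by
  rw [Polynomial.coeff_mul, Finset.Nat.sum_antidiagonal_eq_sum_range_succ_mk,
    Finset.sum_range_succ' _ (2 * p),
    show intChoose (a : ℤ) (((0 : ℕ) : ℤ) - ((i : ℤ) + 1)) = 0 from if_neg (by omega),
    zero_mul, map_zero, zero_mul, add_zero, Finset.mul_sum, Finset.mul_sum]
  have hsub : Finset.range (2 * j + 1).succ ⊆ Finset.range (2 * p) :=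
    Finset.range_subset_range.2 (by omega)
  rw [← Finset.sum_subset hsub]
  · refine Finset.sum_congr rfl fun x hx => ?_
    have hx' : x < 2 * j + 2 := Finset.mem_range.1 hx
    rw [Polynomial.coeff_X_pow_mul', coeff_one_add_C_mul_X_pow]
    split_ifs with hix
    · obtain ⟨s, rfl⟩ := Nat.exists_eq_add_of_le hix
      obtain ⟨y, hy⟩ : ∃ y, 2 * j + 1 = i + s + y := ⟨2 * j + 1 - (i + s), by omega⟩
      have h1 : intChoose (a : ℤ) (((i + s + 1 : ℕ) : ℤ) - ((i : ℤ) + 1)) = a.choose s := by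
        rw [show ((i + s + 1 : ℕ) : ℤ) - ((i : ℤ) + 1) = (s : ℤ) by push_cast; ring]
        simp [intChoose]
      have h2 : 2 * ((j : ℤ) + 1) - ((i + s + 1 : ℕ) : ℤ) = (y : ℤ) := by omega
      have h3 : intChoose (b : ℤ) (y : ℤ) = b.choose y := by simp [intChoose]
      rw [h1, h2, h3, add_comm (Polynomial.C _), Polynomial.coeff_X_add_C_pow, hy,
        show i + s + y - (i + s) = y by omega, show i + s - i = s by omega,
        show (2 * (y : ℤ)).toNat = 2 * y by omega]
      rcases le_or_gt s a with hs | hs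
      · obtain ⟨d, rfl⟩ := Nat.exists_eq_add_of_le hs
        rw [show s + d - s = d by omega]
        simp only [map_mul, map_natCast]
        ring
      · simp [Nat.choose_eq_zero_of_lt hs]
    · rw [show intChoose (a : ℤ) (((x + 1 : ℕ) : ℤ) - ((i : ℤ) + 1)) = 0 from
        if_neg (by omega)]
      simp
  · intro x _ hx
    rw [Finset.mem_range, not_lt] at hx
    rw [show intChoose (b : ℤ) (2 * ((j : ℤ) + 1) - ((x + 1 : ℕ) : ℤ)) = 0 from
      if_neg (by omega)]
    simp

theorem X_pow_mul_det_eq (p k b : ℕ) :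
    (Polynomial.X : Polynomial ℤ) ^ p * (Matrix.of fun i j : Fin p =>
        (Polynomial.X ^ (i : ℕ) * (Polynomial.C Polynomial.X + Polynomial.X) ^ ((i : ℕ) + k) *
          (1 + Polynomial.C Polynomial.X * Polynomial.X) ^ ((j : ℕ) + b) :
            Polynomial (Polynomial ℤ)).coeff (2 * (j : ℕ) + 1)).det =
      Polynomial.X ^ (p * k) * Tpoly (2 * p + k + b - 1) p k := by
  set M : Matrix (Fin p) (Fin p) (Polynomial ℤ) := Matrix.of fun i j : Fin p =>
        (Polynomial.X ^ (i : ℕ) * (Polynomial.C Polynomial.X + Polynomial.X) ^ ((i : ℕ) + k) *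
          (1 + Polynomial.C Polynomial.X * Polynomial.X) ^ ((j : ℕ) + b) :
            Polynomial (Polynomial ℤ)).coeff (2 * (j : ℕ) + 1) with hM
  set E : Matrix (Fin p) (Fin p) (Polynomial ℤ) := Matrix.of fun ℓ m : Fin p =>
    ∑ r ∈ Finset.range (2 * p + 1),
      Polynomial.C (intChoose ((ℓ : ℤ) + 1 + k - 1) ((r : ℤ) - ((ℓ : ℤ) + 1)) *
          intChoose (((m : ℤ) + 1) + (2 * p + k + b - 1) - 2 * p - k)
            (2 * ((m : ℤ) + 1) - (r : ℤ))) *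
        Polynomial.X ^ (2 * (2 * ((m : ℤ) + 1) - (r : ℤ))).toNat with hE
  have hT : Tpoly (2 * p + k + b - 1) p k = E.det := rfl
  have hentry : (Matrix.of fun i j : Fin p =>
      (Polynomial.X : Polynomial ℤ) ^ (2 * (j : ℕ) + 1) * M i j) =
      Matrix.of fun i j : Fin p =>
        (Polynomial.X : Polynomial ℤ) ^ (2 * (i : ℕ) + k) * E i j := by
    ext1 i j
    simp only [hM, hE, Matrix.of_apply]
    rw [X_pow_mul_coeff_two_mul_add_one p i j _ _ j.isLt,
      show (i : ℕ) + k + i = 2 * i + k by ring,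
      show ((i : ℤ) + 1 + k - 1) = (((i : ℕ) + k : ℕ) : ℤ) by push_cast; ring,
      show ((j : ℤ) + 1 + (2 * p + k + b - 1) - 2 * p - k) = (((j : ℕ) + b : ℕ) : ℤ) by
        push_cast; ring]
  clear_value M E
  have hdet := congrArg Matrix.det hentry
  rw [Matrix.det_mul_row, Matrix.det_mul_column, Finset.prod_pow_eq_pow_sum,
    Finset.prod_pow_eq_pow_sum, Finset.sum_add_distrib, Finset.sum_add_distrib] at hdet
  simp only [Finset.sum_const, Finset.card_univ, Fintype.card_fin, smul_eq_mul, mul_one,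
    pow_add, mul_assoc] at hdet
  rw [hT]
  exact mul_left_cancel₀ (pow_ne_zero _ Polynomial.X_ne_zero) hdet

theorem sum_prod_mul_psibarOdd (p k : ℕ) (c : Fin 2 → Polynomial ℤ) :
    ∑ ε : Fin p → Fin 2, (∏ j, c (ε j)) *
        psibarOdd (p + k) (bEpsOdd (p + k) k fun j => if h : j < p then (ε ⟨j, h⟩ : ℕ) else 0) =
      Polynomial.X ^ (k * (k - 1) / 2) * (Matrix.of fun i j : Fin p =>
        (Polynomial.X ^ (i : ℕ) * (Polynomial.C Polynomial.X + Polynomial.X) ^ ((i : ℕ) + k) *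
          (1 + Polynomial.C Polynomial.X * Polynomial.X) ^ ((j : ℕ) + (k + 1)) *
          (Polynomial.C (c 0) + Polynomial.C (c 1) * Polynomial.X) :
            Polynomial (Polynomial ℤ)).coeff (2 * (j : ℕ) + 1)).det := by
  have hpsi : ∀ ε : Fin p → Fin 2,
      psibarOdd (p + k) (bEpsOdd (p + k) k fun j => if h : j < p then (ε ⟨j, h⟩ : ℕ) else 0) =
        Polynomial.X ^ (k * (k - 1) / 2) *
        (Fodd p * ∏ m, Polynomial.aeval (MvPolynomial.X m)
          (((Polynomial.C Polynomial.X + Polynomial.X) *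
            (1 + Polynomial.C Polynomial.X * Polynomial.X)) ^ k :
              Polynomial (Polynomial ℤ))).coeff
          (Finsupp.equivFunOnFinite.symm fun j : Fin p => 2 * (j : ℕ) + 1 - (ε j : ℕ)) := by
    intro ε
    have h := coeff_Fodd_add p k 1
      fun j => 2 * j + 1 - (if h : j < p then (ε ⟨j, h⟩ : ℕ) else 0)
    simp only [map_one, Finset.prod_const_one, mul_one, Polynomial.coeff_one_zero, one_pow,
      one_mul, Fin.is_lt, dif_pos, Fin.eta] at h
    rw [← h, psibarOdd]
    congr 2
    ext l
    rw [bEpsOdd]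
    split_ifs with h1 h2
    · rfl
    · have := (ε ⟨l - k, h2⟩).isLt
      omega
    · omega
  have hG : ∀ m : Fin p, Polynomial.aeval (MvPolynomial.X m : MvPolynomial (Fin p) (Polynomial ℤ))
        (((Polynomial.C Polynomial.X + Polynomial.X) *
          (1 + Polynomial.C Polynomial.X * Polynomial.X)) ^ k : Polynomial (Polynomial ℤ)) *
      Polynomial.aeval (MvPolynomial.X m)
        (Polynomial.C (c 0) + Polynomial.C (c 1) * Polynomial.X) =
      Polynomial.aeval (MvPolynomial.X m)
        (((Polynomial.C Polynomial.X + Polynomial.X) *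
          (1 + Polynomial.C Polynomial.X * Polynomial.X)) ^ k *
            (Polynomial.C (c 0) + Polynomial.C (c 1) * Polynomial.X)) :=
    fun m => (map_mul _ _ _).symm
  rw [Finset.sum_congr rfl fun ε _ => (congrArg _ (hpsi ε)).trans (mul_left_comm _ _ _),
    ← Finset.mul_sum, sum_prod_mul_coeff_sub, mul_assoc (Fodd p), ← Finset.prod_mul_distrib,
    Finset.prod_congr rfl fun m _ => hG m, coeff_Fodd_mul_prod]
  refine congrArg (fun M : Matrix (Fin p) (Fin p) (Polynomial ℤ) => _ * M.det) ?_
  ext1 i j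
  simp only [Matrix.of_apply]
  refine congrArg (fun q : Polynomial (Polynomial ℤ) => q.coeff _) ?_
  rw [quadVar, mul_pow, mul_pow, pow_add, pow_add]
  ring

theorem odd_exponent_eq (p k : ℕ) :
    (((p + k : ℕ) : ℤ) * (((p + k : ℕ) : ℤ) - 1) - (p : ℤ) * ((p : ℤ) + 1)) / 2 =
      ((k * (k - 1) / 2 + p * k : ℕ) : ℤ) - p := by
  have htri : (((k * (k - 1) / 2 : ℕ) : ℤ)) * 2 = k * (k - 1) := by
    have h : k * (k - 1) / 2 * 2 = k * (k - 1) :=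
      Nat.div_mul_cancel (Nat.even_mul_pred_self k).two_dvd
    have h' := congrArg (Nat.cast : ℕ → ℤ) h
    rw [Nat.cast_mul, Nat.cast_mul] at h'
    refine h'.trans ?_
    cases k <;> simp
  refine Int.ediv_eq_of_eq_mul_left two_ne_zero ?_
  rw [sub_mul, Nat.cast_add (k * (k - 1) / 2), add_mul, htri]
  push_cast
  ring

theorem eq_T_sub_mul_of_T_mul_eq {R : Type*} [CommRing R] {a b : ℤ} {x y : LaurentPolynomial R}
    (h : LaurentPolynomial.T a * x = LaurentPolynomial.T b * y) :
    x = LaurentPolynomial.T (b - a) * y := by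
  rw [sub_eq_neg_add, LaurentPolynomial.T_add, mul_assoc, ← h, ← mul_assoc,
    ← LaurentPolynomial.T_add, neg_add_cancel, LaurentPolynomial.T_zero, one_mul]

theorem toLaurent_prod_T {p : ℕ} (ε : Fin p → Fin 2) :
    Polynomial.toLaurent (∏ j, (![1, Polynomial.X] : Fin 2 → Polynomial ℤ) (ε j)) =
      LaurentPolynomial.T (∑ i : Fin p, ((ε i : ℕ) : ℤ)) := by
  have h : ∀ a : Fin 2, (![1, Polynomial.X] : Fin 2 → Polynomial ℤ) a =
      Polynomial.X ^ (a : ℕ) := by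
    intro a
    fin_cases a <;> simp
  rw [Finset.prod_congr rfl fun j _ => h (ε j), Finset.prod_pow_eq_pow_sum,
    Polynomial.toLaurent_X_pow]
  push_cast
  rfl

theorem toLaurent_prod_T_neg {p : ℕ} (ε : Fin p → Fin 2) :
    Polynomial.toLaurent (∏ j, (![Polynomial.X, 1] : Fin 2 → Polynomial ℤ) (ε j)) =
      LaurentPolynomial.T p * LaurentPolynomial.T (-∑ i : Fin p, ((ε i : ℕ) : ℤ)) := by
  have h : ∀ a : Fin 2, (![Polynomial.X, 1] : Fin 2 → Polynomial ℤ) a =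
      Polynomial.X ^ (1 - (a : ℕ)) := by
    intro a
    fin_cases a <;> simp
  rw [Finset.prod_congr rfl fun j _ => h (ε j), Finset.prod_pow_eq_pow_sum,
    Polynomial.toLaurent_X_pow, ← LaurentPolynomial.T_add]
  congr 1
  rw [Nat.cast_sum, Finset.sum_congr rfl fun j _ => Nat.cast_sub (Nat.le_of_lt_succ (ε j).isLt),
    Finset.sum_sub_distrib]
  simp [sub_eq_add_neg]

end Assembly

/-- The odd-size sum rule: with `L = 2n+1`, `0 ≤ p ≤ n`, `p̃ = n-p` and
    `ν = (n(n-1) - p(p+1))/2`, the partial sums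
    `S(L,p|t) = ∑_{ε ∈ {0,1}^p} t^{ε_1+⋯+ε_p} ψ̄_{b(ε)}` satisfy
    `S(L,p|τ) = τ^ν T(L,p,n-p)` and `S(L,p|τ⁻¹) = τ^ν T(L,p,n-p+1)` in `ℤ[τ,τ⁻¹]`. -/
theorem odd_size_sum_rule (n p ptil : ℕ) (hn : 1 ≤ n) (hp : p ≤ n)
    (hptil : ptil = n - p) :
    ((∑ ε : Fin p → Fin 2,
          LaurentPolynomial.T (∑ i : Fin p, ((ε i : ℕ) : ℤ)) *
            Polynomial.toLaurent
              (psibarOdd n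
                (bEpsOdd n ptil fun j => if h : j < p then (ε ⟨j, h⟩ : ℕ) else 0))) =
        LaurentPolynomial.T (((n : ℤ) * ((n : ℤ) - 1) - (p : ℤ) * ((p : ℤ) + 1)) / 2) *
          Polynomial.toLaurent (Tpoly (2 * (n : ℤ) + 1) (p : ℤ) ((n : ℤ) - (p : ℤ)))) ∧
      ((∑ ε : Fin p → Fin 2,
          LaurentPolynomial.T (-∑ i : Fin p, ((ε i : ℕ) : ℤ)) *
            Polynomial.toLaurent
              (psibarOdd n
                (bEpsOdd n ptil fun j => if h : j < p then (ε ⟨j, h⟩ : ℕ) else 0))) =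
        LaurentPolynomial.T (((n : ℤ) * ((n : ℤ) - 1) - (p : ℤ) * ((p : ℤ) + 1)) / 2) *
          Polynomial.toLaurent (Tpoly (2 * (n : ℤ) + 1) (p : ℤ) ((n : ℤ) - (p : ℤ) + 1))) := by
  obtain ⟨k, rfl⟩ : ∃ k, n = p + k := Nat.exists_eq_add_of_le hp
  obtain rfl : ptil = k := by omega
  rw [odd_exponent_eq, show ((p + ptil : ℕ) : ℤ) - p = ptil by push_cast; ring]
  refine ⟨eq_T_sub_mul_of_T_mul_eq ?_, eq_T_sub_mul_of_T_mul_eq ?_⟩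
  · have h := congrArg (Polynomial.X ^ p * ·) (sum_prod_mul_psibarOdd p ptil ![1, Polynomial.X])
    have hb : ∀ i j : Fin p, (Polynomial.X ^ (i : ℕ) *
          (Polynomial.C Polynomial.X + Polynomial.X) ^ ((i : ℕ) + ptil) *
          (1 + Polynomial.C Polynomial.X * Polynomial.X) ^ ((j : ℕ) + (ptil + 1)) *
          (Polynomial.C 1 + Polynomial.C Polynomial.X * Polynomial.X) :
            Polynomial (Polynomial ℤ)) = Polynomial.X ^ (i : ℕ) *
          (Polynomial.C Polynomial.X + Polynomial.X) ^ ((i : ℕ) + ptil) *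
          (1 + Polynomial.C Polynomial.X * Polynomial.X) ^ ((j : ℕ) + (ptil + 2)) := by
      intro i j
      rw [Polynomial.C_1]
      ring
    simp only [Matrix.cons_val_zero, Matrix.cons_val_one, hb] at h
    rw [mul_left_comm _ (Polynomial.X ^ (ptil * (ptil - 1) / 2)), X_pow_mul_det_eq] at h
    have hL := congrArg Polynomial.toLaurent h
    rw [← mul_assoc, ← pow_add, map_mul, map_mul, Polynomial.toLaurent_X_pow,
      Polynomial.toLaurent_X_pow, map_sum] at hL
    simp only [map_mul, toLaurent_prod_T] at hL
    rw [hL]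
    congr 3
    push_cast
    ring
  · have h := congrArg (Polynomial.X ^ p * ·) (sum_prod_mul_psibarOdd p ptil ![Polynomial.X, 1])
    have hb : ∀ i j : Fin p, (Polynomial.X ^ (i : ℕ) *
          (Polynomial.C Polynomial.X + Polynomial.X) ^ ((i : ℕ) + ptil) *
          (1 + Polynomial.C Polynomial.X * Polynomial.X) ^ ((j : ℕ) + (ptil + 1)) *
          (Polynomial.C Polynomial.X + Polynomial.C 1 * Polynomial.X) :
            Polynomial (Polynomial ℤ)) = Polynomial.X ^ (i : ℕ) *
          (Polynomial.C Polynomial.X + Polynomial.X) ^ ((i : ℕ) + (ptil + 1)) *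
          (1 + Polynomial.C Polynomial.X * Polynomial.X) ^ ((j : ℕ) + (ptil + 1)) := by
      intro i j
      rw [Polynomial.C_1]
      ring
    simp only [Matrix.cons_val_zero, Matrix.cons_val_one, hb] at h
    rw [mul_left_comm _ (Polynomial.X ^ (ptil * (ptil - 1) / 2)), X_pow_mul_det_eq,
      mul_add_one, add_comm (p * ptil), pow_add _ p, mul_assoc (Polynomial.X ^ p),
      mul_left_comm _ (Polynomial.X ^ p)] at h
    have hL := congrArg Polynomial.toLaurent
      (mul_left_cancel₀ (pow_ne_zero _ Polynomial.X_ne_zero) h)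
    rw [← mul_assoc, ← pow_add, map_mul, Polynomial.toLaurent_X_pow, map_sum] at hL
    simp only [map_mul, toLaurent_prod_T_neg, mul_assoc, ← Finset.mul_sum] at hL
    rw [hL]
    congr 3
    push_cast
    ring
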